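/- arXiv:1507.08005 — 8 statements merged into one kernel-verified Lean document; each statement's English description precedes it below -/
import Mathlib

section
/- Let F be the free group on four generators x, y, z, w, and let C = [[x,y],[z,w]] where [a,b] = a⁻¹b⁻¹ab. Then there exist elements u₁, u₂, …, u₁₄ of F such that C = u₁³u₂³⋯u₁₄³; that is, the commutator of commutators is a product of 14 cubes in the free group of rank 4. -/
/-- In the free group of rank 4, the commutator of commutators
`C = [[x,y],[z,w]]` (with `[a,b] = a⁻¹b⁻¹ab`) is a product of 14 cubes. -/
theorem commutator_of_commutators_prod_of_14_cubes :
    let F := FreeGroup (Fin 4)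
    let x : F := FreeGroup.of 0
    let y : F := FreeGroup.of 1
    let z : F := FreeGroup.of 2
    let w : F := FreeGroup.of 3
    let comm : F → F → F := fun a b => a⁻¹ * b⁻¹ * a * b
    let C : F := comm (comm x y) (comm z w)
    ∃ u : Fin 14 → F, C = (List.ofFn fun i => (u i) ^ 3).prod := by
  intro F x y z w comm C
  let g1 : F := y⁻¹
  let g2 : F := g1 * (w * x⁻¹ * y⁻¹ * x)
  let g3 : F := g2 * (z * x⁻¹ * y * x * w⁻¹)
  let g4 : F := y⁻¹ * w * x⁻¹ * y⁻¹
  let g5 : F := w⁻¹ * z⁻¹ * w * z * x * z * y * x * z * x * w⁻¹ * x⁻¹ * y * x * z * w * x⁻¹ * y⁻¹ * x * w * x⁻¹ * y * x * w⁻¹ * y * w⁻¹ * z⁻¹ * w * x⁻¹ * z⁻¹ * x⁻¹ * y * x * z * x * w⁻¹ * x⁻¹ * y * x * z * x * w⁻¹ * x⁻¹ * y * x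
  let g6 : F := g5 * (w * x⁻¹ * w * y⁻¹ * w * x⁻¹ * y⁻¹ * x * w⁻¹ * x⁻¹ * y * x * w⁻¹ * x * w⁻¹ * x⁻¹ * y * x)
  let g7 : F := g6 * (w⁻¹ * x * w⁻¹)
  let g8 : F := g7 * (x⁻¹ * w * x⁻¹ * y⁻¹ * w * x⁻¹ * y⁻¹)
  let g9 : F := g8 * (y * x * w⁻¹ * y * x * w⁻¹)
  let g10 : F := g9 * (x * w * x⁻¹ * w * x⁻¹ * y⁻¹ * x * w * x⁻¹ * w * x⁻¹ * y⁻¹ * x * w * x⁻¹ * y * x * w⁻¹ * y * w⁻¹ * x * w⁻¹ * x⁻¹ * y⁻¹ * x * w * x⁻¹ * w * x⁻¹ * y⁻¹ * x * w * x⁻¹ * y * x * w⁻¹ * y * w⁻¹ * z⁻¹ * w * x⁻¹ * z⁻¹)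
  let g11 : F := g10 * (z * x * w⁻¹ * z * w * y⁻¹ * w * x⁻¹ * y⁻¹ * x * w⁻¹ * x⁻¹ * y * x * w⁻¹ * z⁻¹ * x⁻¹ * y⁻¹ * x * w * x⁻¹ * z⁻¹ * x⁻¹ * y⁻¹ * x * z * x)
  let g12 : F := w⁻¹ * z⁻¹ * w * z
  let g13 : F := g12 * (y⁻¹ * z⁻¹ * x⁻¹ * y⁻¹)
  let g14 : F := g13 * (y * x * z)
  refine ⟨![
    g1 * (x⁻¹ * y * x * w⁻¹) * g1⁻¹,
    g2 * (w * x⁻¹ * y⁻¹ * x * z⁻¹) * g2⁻¹,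
    g3 * (z * x⁻¹ * y * x) * g3⁻¹,
    g4 * (y⁻¹ * x * w * x⁻¹) * g4⁻¹,
    g5 * (z * x * w⁻¹) * g5⁻¹,
    g6 * (w * x⁻¹ * w) * g6⁻¹,
    g7 * (w⁻¹ * x) * g7⁻¹,
    g8 * (x * w⁻¹ * x⁻¹ * y * x * w⁻¹) * g8⁻¹,
    g9 * (w * x⁻¹ * y⁻¹) * g9⁻¹,
    g10 * (w * x⁻¹ * z⁻¹ * x⁻¹ * y⁻¹ * x) * g10⁻¹,
    g11 * (x⁻¹ * z⁻¹) * g11⁻¹,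
    g12 * (x * z * y) * g12⁻¹,
    g13 * (x * w⁻¹ * x⁻¹ * y * x * z * x⁻¹ * y) * g13⁻¹,
    g14 * (z⁻¹ * x⁻¹ * y⁻¹ * y⁻¹ * x) * g14⁻¹], ?_⟩
  apply FreeGroup.toWord_injective
  decide +kernel
end

section
/- For every group G and all elements a, b, c, d of G, there exist elements u₁, u₂, …, u₁₄ of G such that [[a,b],[c,d]] = u₁³u₂³⋯u₁₄³, where [a,b] = a⁻¹b⁻¹ab; that is, in any group every commutator of commutators is a product of 14 cubes. -/
/-- `g` is a product of `n` cubes. -/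
def IsProdCubes {G : Type*} [Group G] (n : ℕ) (g : G) : Prop :=
  ∃ u : Fin n → G, g = (List.ofFn fun i => (u i) ^ 3).prod

theorem IsProdCubes.conj {G : Type*} [Group G] {n : ℕ} {g : G} (h : IsProdCubes n g) (k : G) :
    IsProdCubes n (k * g * k⁻¹) := by
  obtain ⟨u, rfl⟩ := h
  refine ⟨fun i => k * u i * k⁻¹, ?_⟩
  simp only [conj_pow]
  have := map_list_prod (MulAut.conj k) (List.ofFn fun i => (u i) ^ 3)
  rw [List.map_ofFn] at this
  simpa [Function.comp_def] using this

theorem IsProdCubes.inv {G : Type*} [Group G] {n : ℕ} {g : G} (h : IsProdCubes n g) :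
    IsProdCubes n g⁻¹ := by
  obtain ⟨u, rfl⟩ := h
  induction n with
  | zero => exact ⟨u, by simp⟩
  | succ n ih =>
    obtain ⟨v, hv⟩ := ih (fun i => u i.succ)
    refine ⟨Fin.snoc v (u 0)⁻¹, ?_⟩
    rw [List.ofFn_succ, List.prod_cons, mul_inv_rev, hv, List.ofFn_succ']
    simp [List.concat_eq_append]

theorem IsProdCubes.step {G : Type*} [Group G] {n : ℕ} {y : G} (h : IsProdCubes n y)
    (g u k : G) {x : G} (hx : x = g * (u * u * u) * g⁻¹ * (k * y * k⁻¹)) :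
    IsProdCubes (n + 1) x := by
  obtain ⟨v, hv⟩ := h.conj k
  refine ⟨Fin.cons (g * u * g⁻¹) v, ?_⟩
  rw [List.ofFn_succ, List.prod_cons, hx, hv]
  simp [pow_succ]

theorem isProdCubes_zero {G : Type*} [Group G] : IsProdCubes 0 (1 : G) := ⟨fun _ => 1, by simp⟩

theorem cubes_aux_13 {G : Type*} [Group G] (a b c d : G) :
    IsProdCubes 1 (a * b * a * b * a * b) := by
  refine isProdCubes_zero.step (1) (a * b) (1) ?_
  simp [mul_assoc]

theorem cubes_aux_12 {G : Type*} [Group G] (a b c d : G) :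
    IsProdCubes 2 (a * a * b * a * b⁻¹ * a⁻¹ * b⁻¹ * a * b) := by
  refine (cubes_aux_13 (a⁻¹) (b⁻¹) 1 1).step (1) (a * a * b) (b⁻¹ * a⁻¹) ?_
  simp [mul_assoc]

theorem cubes_aux_11 {G : Type*} [Group G] (a b c d : G) :
    IsProdCubes 3 (a * a * b * a * b⁻¹ * c * b * a * c * b * a * c * a * b) := by
  refine (cubes_aux_12 (a) (b) 1 1).step (a * a * b * a * b⁻¹) (c * b * a) (a * a * b * a * b⁻¹ * a⁻¹ * b⁻¹ * a * b) ?_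
  simp [mul_assoc]

theorem cubes_aux_10 {G : Type*} [Group G] (a b c d : G) :
    IsProdCubes 4 (a * b * a⁻¹ * b⁻¹ * a⁻¹ * c * a⁻¹ * b⁻¹ * a * c⁻¹ * a * c * b * c⁻¹) := by
  refine (cubes_aux_11 (a) (c⁻¹) (b) 1).step (a * b) (a⁻¹ * b⁻¹ * a⁻¹ * c) (a * b * c⁻¹ * a * b * a * c⁻¹) ?_
  simp [mul_assoc]

theorem cubes_aux_9 {G : Type*} [Group G] (a b c d : G) :
    IsProdCubes 5 (a * a * b * a * c * b⁻¹ * a⁻¹ * b * c⁻¹ * b * c * a * c⁻¹ * b) := by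
  refine (cubes_aux_10 (b) (a) (c) 1).step (a) (a * b) (a * b⁻¹ * a⁻¹ * b⁻¹ * c * b⁻¹ * a⁻¹ * b * c⁻¹ * b * c * a * c⁻¹) ?_
  simp [mul_assoc]

theorem cubes_aux_8 {G : Type*} [Group G] (a b c d : G) :
    IsProdCubes 6 (a * a * b * a * c * b⁻¹ * a⁻¹ * d * c * b⁻¹ * d * c * b⁻¹ * d * b * c * a * c⁻¹ * b) := by
  refine (cubes_aux_9 (a) (b) (c) 1).step (a * a * b * a * c * b⁻¹ * a⁻¹) (d * c * b⁻¹) (a * a * b * a * c * b⁻¹ * a⁻¹ * b * c⁻¹ * b * c * a * c⁻¹ * b) ?_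
  simp [mul_assoc]

theorem cubes_aux_7 {G : Type*} [Group G] (a b c d : G) :
    IsProdCubes 7 (a * a * b * a * c * a * b * d * c * a * c⁻¹ * d⁻¹ * b⁻¹ * c⁻¹ * b * d⁻¹ * a * d * b) := by
  refine (cubes_aux_8 (a) (b) (d⁻¹) (c⁻¹)).step (a * a * b * a) (c * a * b * d) (a * a * b * a * d⁻¹ * b⁻¹ * a⁻¹ * c⁻¹ * d⁻¹ * b⁻¹ * c⁻¹ * d⁻¹ * b⁻¹ * c⁻¹ * b * d⁻¹ * a * d * b) ?_
  simp [mul_assoc]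

theorem cubes_aux_6 {G : Type*} [Group G] (a b c d : G) :
    IsProdCubes 8 (a * b * a⁻¹ * c * b⁻¹ * a * b⁻¹ * d * b⁻¹ * a * b * d⁻¹ * c * b * c⁻¹ * d⁻¹ * a * d * c⁻¹) := by
  refine (cubes_aux_7 (b⁻¹) (d) (a) (c⁻¹)).inv.step (a * b * a⁻¹ * c) (b⁻¹ * a * b⁻¹ * d) (c * d⁻¹ * a⁻¹ * d * c * b⁻¹ * c⁻¹ * d) ?_
  simp [mul_assoc]

theorem cubes_aux_5 {G : Type*} [Group G] (a b c d : G) :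
    IsProdCubes 9 (a * b * a⁻¹ * b⁻¹ * c * b⁻¹ * c * d * b⁻¹ * c * d⁻¹ * b * d⁻¹ * a⁻¹ * d⁻¹ * b * d * a * c * d * c⁻¹) := by
  refine (cubes_aux_6 (b) (d) (c) (a⁻¹)).step (a * b * a⁻¹) (b⁻¹ * c) (a * b * a⁻¹ * c⁻¹) ?_
  simp [mul_assoc]

theorem cubes_aux_4 {G : Type*} [Group G] (a b c d : G) :
    IsProdCubes 10 (a * a * b * a * c * a * b * a⁻¹ * c⁻¹ * d * a⁻¹ * d⁻¹ * c⁻¹ * b * c * b⁻¹ * d * a * d⁻¹ * b) := by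
  refine (cubes_aux_5 (c⁻¹) (b) (d) (a⁻¹)).step (a * a * b * a * c * a * b * a⁻¹ * c⁻¹ * d * a⁻¹ * d⁻¹ * c⁻¹ * b * c * b⁻¹ * d) (a * d⁻¹ * b) (a * a * b * a * c * a * b * a⁻¹ * c⁻¹ * d * a⁻¹ * d⁻¹ * c⁻¹ * b * c * b⁻¹ * d * b⁻¹ * d * a⁻¹ * b⁻¹ * d * a * b * a * c * a * b * a⁻¹ * c⁻¹ * d * a⁻¹ * d⁻¹) ?_
  simp [mul_assoc]

theorem cubes_aux_3 {G : Type*} [Group G] (a b c d : G) :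
    IsProdCubes 11 (a * a * b * a⁻¹ * b⁻¹ * c * d * c⁻¹ * d⁻¹ * b * a * b⁻¹ * d⁻¹ * a * c⁻¹ * a⁻¹ * d * a * c) := by
  refine (cubes_aux_4 (a) (c) (d⁻¹) (b)).inv.step (a * a * b * a⁻¹ * b⁻¹ * c * d * c⁻¹ * d⁻¹ * b * a * b⁻¹ * d⁻¹ * a * c⁻¹ * a⁻¹ * d) (a * c * a) (a * a * c) ?_
  simp [mul_assoc]

theorem cubes_aux_2 {G : Type*} [Group G] (a b c d : G) :
    IsProdCubes 12 (a * b * a⁻¹ * b⁻¹ * c * b * c * d * b * c * b⁻¹ * d⁻¹ * a * b⁻¹ * a⁻¹ * d⁻¹ * c * d * c⁻¹) := by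
  refine (cubes_aux_3 (b) (a) (c) (d⁻¹)).inv.step (a * b * a⁻¹ * b⁻¹) (c * b) (c * d⁻¹ * c⁻¹ * d * a * b * a⁻¹ * d * b * c⁻¹ * b⁻¹ * d⁻¹ * b * c) ?_
  simp [mul_assoc]

theorem cubes_aux_1 {G : Type*} [Group G] (a b c d : G) :
    IsProdCubes 13 (a * b * a⁻¹ * b⁻¹ * c * d * c⁻¹ * d⁻¹ * b * a * b⁻¹ * d⁻¹ * a * d⁻¹ * a * c * d⁻¹ * c⁻¹) := by
  refine (cubes_aux_2 (c) (d) (b) (a⁻¹)).step (a * b * a⁻¹ * b⁻¹ * c * d * c⁻¹ * d⁻¹ * b) (a * b⁻¹ * d⁻¹) (a * b * a⁻¹ * b⁻¹ * c * d * c⁻¹ * d⁻¹ * b * d * b * a⁻¹ * d * b * d⁻¹ * a * c * d⁻¹ * c⁻¹ * a * b * a⁻¹ * b⁻¹) ?_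
  simp [mul_assoc]

theorem cubes_aux_0 {G : Type*} [Group G] (a b c d : G) :
    IsProdCubes 14 (a * b * a⁻¹ * b⁻¹ * c * d * c⁻¹ * d⁻¹ * b * a * b⁻¹ * a⁻¹ * d * c * d⁻¹ * c⁻¹) := by
  refine (cubes_aux_1 (c) (d) (b) (a)).step (1) (a * c⁻¹) (c * a⁻¹ * c * a⁻¹ * c * b * a⁻¹ * b⁻¹) ?_
  simp [mul_assoc]

/-- In any group, every commutator of commutators
`[[a,b],[c,d]]` (with `[a,b] = a⁻¹b⁻¹ab`) is a product of 14 cubes. -/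
theorem commutator_of_commutators_prod_of_14_cubes_in_any_group
    {G : Type*} [Group G] (a b c d : G) :
    ∃ u : Fin 14 → G,
      ((a⁻¹ * b⁻¹ * a * b)⁻¹ * (c⁻¹ * d⁻¹ * c * d)⁻¹ *
        (a⁻¹ * b⁻¹ * a * b) * (c⁻¹ * d⁻¹ * c * d)) =
        (List.ofFn fun i => (u i) ^ 3).prod := by
  have h := (cubes_aux_0 (b⁻¹) (a⁻¹) (d⁻¹) (c⁻¹)).conj (1)
  obtain ⟨u, hu⟩ := h
  refine ⟨u, ?_⟩
  rw [← hu]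
  simp [mul_assoc]
end

section
/- Let F be the free group on four generators x, y, z, w, let H be the subgroup of F generated by x, y, z, and let β = y⁻¹·z⁻¹·x⁻¹·z·y·x·z⁻¹·x·z·x⁻¹·z·x⁻¹·y⁻¹·x·y·z⁻¹. Then β lies in H, and there exist elements u₁, u₂, …, u₆ of H such that β = u₁³u₂³⋯u₆³; that is, β is a product of 6 cubes of elements of the subgroup generated by x, y, z. -/
theorem beta_aux {G : Type*} [Group G] (x y z : G) :
    y⁻¹ * z⁻¹ * x⁻¹ * z * y * x * z⁻¹ * x * z * x⁻¹ * z * x⁻¹ *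
      y⁻¹ * x * y * z⁻¹ =
    (y⁻¹ * z⁻¹ * x⁻¹ * z * y * x * z⁻¹ * y⁻¹ * z⁻¹ * x * z * y) ^ 3 *
    (y⁻¹ * z⁻¹ * x⁻¹ * z * y * z * z * y) ^ 3 *
    (y⁻¹ * z⁻¹ * z⁻¹) ^ 3 *
    (z * z * y * z⁻¹) ^ 3 *
    (z * y⁻¹ * z⁻¹ * y⁻¹ * x * y * z⁻¹) ^ 3 *
    (z * y⁻¹ * x⁻¹ * y * z * x⁻¹ * y⁻¹ * x * y * z⁻¹) ^ 3 := by
  simp only [pow_succ, pow_zero, one_mul, mul_assoc, mul_inv_cancel_left, inv_mul_cancel_left]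

/-- In the free group of rank 4, the element `β` below lies in
the subgroup `H = ⟨x,y,z⟩` and is a product of 6 cubes of elements of `H`. -/
theorem beta_mem_and_prod_of_6_cubes :
    let F := FreeGroup (Fin 4)
    let x : F := FreeGroup.of 0
    let y : F := FreeGroup.of 1
    let z : F := FreeGroup.of 2
    let H : Subgroup F := Subgroup.closure {x, y, z}
    let β : F := y⁻¹ * z⁻¹ * x⁻¹ * z * y * x * z⁻¹ * x * z * x⁻¹ * z * x⁻¹ *
      y⁻¹ * x * y * z⁻¹
    β ∈ H ∧ ∃ u : Fin 6 → F, (∀ i, u i ∈ H) ∧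
      β = (List.ofFn fun i => (u i) ^ 3).prod := by
  intro F x y z H β
  have hx : x ∈ H := Subgroup.subset_closure (by simp)
  have hy : y ∈ H := Subgroup.subset_closure (by simp)
  have hz : z ∈ H := Subgroup.subset_closure (by simp)
  have hx' := H.inv_mem hx
  have hy' := H.inv_mem hy
  have hz' := H.inv_mem hz
  refine ⟨?_, ![y⁻¹ * z⁻¹ * x⁻¹ * z * y * x * z⁻¹ * y⁻¹ * z⁻¹ * x * z * y,
    y⁻¹ * z⁻¹ * x⁻¹ * z * y * z * z * y,
    y⁻¹ * z⁻¹ * z⁻¹,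
    z * z * y * z⁻¹,
    z * y⁻¹ * z⁻¹ * y⁻¹ * x * y * z⁻¹,
    z * y⁻¹ * x⁻¹ * y * z * x⁻¹ * y⁻¹ * x * y * z⁻¹], ?_, ?_⟩
  · repeat' first | assumption | apply H.mul_mem
  · intro i
    fin_cases i <;> dsimp <;> repeat' first | assumption | apply H.mul_mem
  · refine (beta_aux x y z).trans ?_
    simp only [List.ofFn_succ, List.ofFn_zero, List.prod_cons, List.prod_nil, mul_one, mul_assoc]
    rfl
end

section
/- Let F be the free group on four generators x, y, z, w, and let δ = w⁻¹zw·y⁻¹x⁻¹yx·w⁻¹z⁻¹w·x⁻¹·z⁻¹·y⁻¹·z·x·y·z⁻¹·y·z·y⁻¹. Then there exist elements u₁, u₂, …, u₈ of F such that δ = u₁³u₂³⋯u₈³; that is, δ is a product of 8 cubes in F. -/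
set_option maxRecDepth 100000 in
set_option maxHeartbeats 4000000 in
theorem delta_aux {G : Type*} [Group G] (x y z w : G) :
    w⁻¹ * z * w * (y⁻¹ * x⁻¹ * y * x) * (w⁻¹ * z⁻¹ * w) *
      x⁻¹ * z⁻¹ * y⁻¹ * z * x * y * z⁻¹ * y * z * y⁻¹ =
    (w⁻¹ * z * w * y⁻¹ * x⁻¹ * y * x * w⁻¹ * z⁻¹ * w * x⁻¹ * w * x⁻¹ * y⁻¹ * x * y * w⁻¹ * z⁻¹ * w) ^ 3 *
    ((w⁻¹ * z * w * y⁻¹ * x⁻¹ * y * x * w⁻¹ * y⁻¹ * x * y * w⁻¹ * z⁻¹ * w) ^ 3 *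
    ((w⁻¹ * z * w * y⁻¹ * x⁻¹ * y * w * x⁻¹ * z * x * w⁻¹ * y⁻¹ * x * w⁻¹ * y⁻¹ * x * y * w⁻¹ * z⁻¹ * w) ^ 3 *
    ((w⁻¹ * z * w * y⁻¹ * x⁻¹ * y * w * y * w⁻¹ * z⁻¹ * w) ^ 3 *
    ((w⁻¹ * z * w * y⁻¹ * w⁻¹ * y⁻¹ * z⁻¹ * y * w * y * y * w * y * w⁻¹ * z⁻¹ * w) ^ 3 *
    ((w⁻¹ * z * y⁻¹) ^ 3 *
    ((y * z⁻¹ * w * y * z⁻¹ * w * y * w * y⁻¹ * w⁻¹ * y⁻¹ * w⁻¹ * y⁻¹ * w⁻¹ * z * y⁻¹ * w⁻¹ * z * y⁻¹) ^ 3 *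
    ((y * z⁻¹ * w * y * z⁻¹ * w * y * z * y⁻¹ * w⁻¹ * z * y⁻¹) ^ 3 *
    (1)))))))) := by
  simp only [pow_succ, pow_zero, mul_assoc, one_mul, mul_one, mul_inv_cancel_left, inv_mul_cancel_left, mul_inv_cancel, inv_mul_cancel]

/-- In the free group of rank 4, the element `δ` below is a
product of 8 cubes. -/
theorem delta_prod_of_8_cubes :
    let F := FreeGroup (Fin 4)
    let x : F := FreeGroup.of 0
    let y : F := FreeGroup.of 1
    let z : F := FreeGroup.of 2
    let w : F := FreeGroup.of 3
    let δ : F := w⁻¹ * z * w * (y⁻¹ * x⁻¹ * y * x) * (w⁻¹ * z⁻¹ * w) *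
      x⁻¹ * z⁻¹ * y⁻¹ * z * x * y * z⁻¹ * y * z * y⁻¹
    ∃ u : Fin 8 → F, δ = (List.ofFn fun i => (u i) ^ 3).prod := by
  intro F x y z w δ
  exact ⟨![w⁻¹ * z * w * y⁻¹ * x⁻¹ * y * x * w⁻¹ * z⁻¹ * w * x⁻¹ * w * x⁻¹ * y⁻¹ * x * y * w⁻¹ * z⁻¹ * w,
    w⁻¹ * z * w * y⁻¹ * x⁻¹ * y * x * w⁻¹ * y⁻¹ * x * y * w⁻¹ * z⁻¹ * w,
    w⁻¹ * z * w * y⁻¹ * x⁻¹ * y * w * x⁻¹ * z * x * w⁻¹ * y⁻¹ * x * w⁻¹ * y⁻¹ * x * y * w⁻¹ * z⁻¹ * w,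
    w⁻¹ * z * w * y⁻¹ * x⁻¹ * y * w * y * w⁻¹ * z⁻¹ * w,
    w⁻¹ * z * w * y⁻¹ * w⁻¹ * y⁻¹ * z⁻¹ * y * w * y * y * w * y * w⁻¹ * z⁻¹ * w,
    w⁻¹ * z * y⁻¹,
    y * z⁻¹ * w * y * z⁻¹ * w * y * w * y⁻¹ * w⁻¹ * y⁻¹ * w⁻¹ * y⁻¹ * w⁻¹ * z * y⁻¹ * w⁻¹ * z * y⁻¹,
    y * z⁻¹ * w * y * z⁻¹ * w * y * z * y⁻¹ * w⁻¹ * z * y⁻¹],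
    delta_aux x y z w⟩
end

section
/- Let F be the free group on four generators x, y, z, w, let H be the subgroup of F generated by x, y, z, and let ε = y·z⁻¹·y⁻¹·z·y⁻¹·x⁻¹·z⁻¹·y·z·x·z·x⁻¹·y⁻¹·x·y·z⁻¹. Then ε lies in H, and there exist elements u₁, u₂, …, u₆ of H such that ε = u₁³u₂³⋯u₆³; that is, ε is a product of 6 cubes of elements of the subgroup generated by x, y, z. -/
theorem epsilon_aux {G : Type*} [Group G] (x y z : G) :
    y * z⁻¹ * y⁻¹ * z * y⁻¹ * x⁻¹ * z⁻¹ * y * z * x * z * x⁻¹ *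
      y⁻¹ * x * y * z⁻¹ =
    (y * z⁻¹ * y⁻¹ * z * y⁻¹ * x⁻¹ * z⁻¹ * y * z * x * z * y⁻¹ * z * x * y * z⁻¹ * y * z * y⁻¹) ^ 3 *
    ((y * z⁻¹ * y⁻¹ * z * y⁻¹ * x⁻¹ * z⁻¹ * y * z⁻¹ * x⁻¹ * z⁻¹ * z⁻¹ * x⁻¹ * z * x * z * y⁻¹ * z * x * y * z⁻¹ * y * z * y⁻¹) ^ 3 *
    ((y * z⁻¹) ^ 3 *
    ((z * y⁻¹ * z * y⁻¹ * x * y * z⁻¹) ^ 3 *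
    ((z * y⁻¹ * x⁻¹ * y * z⁻¹ * x⁻¹ * y * z⁻¹ * x⁻¹ * z⁻¹ * x * z * y⁻¹ * x * y * z⁻¹) ^ 3 *
    ((z * y⁻¹ * x⁻¹ * y * z⁻¹ * x⁻¹ * z * x * z * y⁻¹ * z * x * z * y⁻¹ * x⁻¹ * z⁻¹ * y * z⁻¹ * x⁻¹ * z⁻¹ * x * z * y⁻¹ * x * y * z⁻¹) ^ 3 * 1))))) := by
  simp only [pow_succ, pow_zero, one_mul, mul_assoc, mul_inv_cancel_left, inv_mul_cancel_left,
    mul_inv_cancel, inv_mul_cancel, mul_one]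

/-- In the free group of rank 4, the element `ε` below lies in
the subgroup `H = ⟨x,y,z⟩` and is a product of 6 cubes of elements of `H`. -/
theorem epsilon_mem_and_prod_of_6_cubes :
    let F := FreeGroup (Fin 4)
    let x : F := FreeGroup.of 0
    let y : F := FreeGroup.of 1
    let z : F := FreeGroup.of 2
    let H : Subgroup F := Subgroup.closure {x, y, z}
    let ε : F := y * z⁻¹ * y⁻¹ * z * y⁻¹ * x⁻¹ * z⁻¹ * y * z * x * z * x⁻¹ *
      y⁻¹ * x * y * z⁻¹
    ε ∈ H ∧ ∃ u : Fin 6 → F, (∀ i, u i ∈ H) ∧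
      ε = (List.ofFn fun i => (u i) ^ 3).prod := by
  intro F x y z H ε
  have hx : x ∈ H := Subgroup.subset_closure (by simp)
  have hy : y ∈ H := Subgroup.subset_closure (by simp)
  have hz : z ∈ H := Subgroup.subset_closure (by simp)
  have hx' : x⁻¹ ∈ H := H.inv_mem hx
  have hy' : y⁻¹ ∈ H := H.inv_mem hy
  have hz' : z⁻¹ ∈ H := H.inv_mem hz
  clear_value H
  refine ⟨?_, ![y * z⁻¹ * y⁻¹ * z * y⁻¹ * x⁻¹ * z⁻¹ * y * z * x * z * y⁻¹ * z * x * y * z⁻¹ * y * z * y⁻¹,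
      y * z⁻¹ * y⁻¹ * z * y⁻¹ * x⁻¹ * z⁻¹ * y * z⁻¹ * x⁻¹ * z⁻¹ * z⁻¹ * x⁻¹ * z * x * z * y⁻¹ * z * x * y * z⁻¹ * y * z * y⁻¹,
      y * z⁻¹,
      z * y⁻¹ * z * y⁻¹ * x * y * z⁻¹,
      z * y⁻¹ * x⁻¹ * y * z⁻¹ * x⁻¹ * y * z⁻¹ * x⁻¹ * z⁻¹ * x * z * y⁻¹ * x * y * z⁻¹,
      z * y⁻¹ * x⁻¹ * y * z⁻¹ * x⁻¹ * z * x * z * y⁻¹ * z * x * z * y⁻¹ * x⁻¹ * z⁻¹ * y * z⁻¹ * x⁻¹ * z⁻¹ * x * z * y⁻¹ * x * y * z⁻¹], ?_, ?_⟩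
  · show y * z⁻¹ * y⁻¹ * z * y⁻¹ * x⁻¹ * z⁻¹ * y * z * x * z * x⁻¹ *
      y⁻¹ * x * y * z⁻¹ ∈ H
    repeat' apply H.mul_mem
    all_goals assumption
  · intro i
    fin_cases i <;> dsimp <;> (repeat' apply H.mul_mem) <;> assumption
  · simp only [List.ofFn_succ, List.ofFn_zero, List.prod_cons, List.prod_nil]
    exact epsilon_aux x y z
end

section
/- Let F be the free group on four generators x, y, z, w, and let C = [[x,y],[z,w]] where [a,b] = a⁻¹b⁻¹ab. Then there exist elements v₁, v₂, …, v₁₅ of F and elements g₁, g₂, …, g₁₅ of F such that C = (g₁⁻¹v₁³g₁)(g₂⁻¹v₂³g₂)⋯(g₁₅⁻¹v₁₅³g₁₅) and the sum of the word lengths of v₁, …, v₁₅ (with respect to the free generators x, y, z, w) is 32; that is, C is a product of 15 conjugated cubes whose cubed words have total length 96. -/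
/-- In the free group of rank 4, `C = [[x,y],[z,w]]` is a product
of 15 conjugated cubes `gᵢ⁻¹ vᵢ³ gᵢ` where the total of the reduced word
lengths of the `vᵢ` is 32 (so the cubed words have total length 96). -/
theorem commutator_of_commutators_prod_of_15_conjugated_cubes :
    let F := FreeGroup (Fin 4)
    let x : F := FreeGroup.of 0
    let y : F := FreeGroup.of 1
    let z : F := FreeGroup.of 2
    let w : F := FreeGroup.of 3
    let comm : F → F → F := fun a b => a⁻¹ * b⁻¹ * a * b
    let C : F := comm (comm x y) (comm z w)
    ∃ (v g : Fin 15 → F),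
      C = (List.ofFn fun i => (g i)⁻¹ * (v i) ^ 3 * (g i)).prod ∧
      (∑ i, ((v i).toWord).length) = 32 := by
  intro F x y z w comm C
  refine ⟨![x * w⁻¹, x⁻¹ * y * w, w, y⁻¹ * w⁻¹, w * x⁻¹ * z⁻¹, w⁻¹ * z, z * x, z⁻¹, y⁻¹ * x, x⁻¹, x⁻¹ * z⁻¹ * y, w * z⁻¹ * y, y, y⁻¹ * z, x * w⁻¹ * y⁻¹ * z], ![y⁻¹ * x * y,
      y,
      z⁻¹ * w * z * y⁻¹ * x⁻¹ * y * x * z⁻¹ * w⁻¹ * z * x * w⁻¹ * y * w * x⁻¹ * y * w * y,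
      1,
      y * w * x⁻¹ * w⁻¹ * y⁻¹ * w⁻¹,
      z * y⁻¹ * x⁻¹ * y * x * z⁻¹ * x⁻¹ * z⁻¹ * w * x⁻¹ * z⁻¹ * y * w * x⁻¹ * w⁻¹ * y⁻¹ * w⁻¹,
      w * x⁻¹ * z⁻¹ * y * w * x⁻¹ * w⁻¹ * y⁻¹ * w⁻¹,
      y⁻¹ * x⁻¹ * y * x * x * z * x * w * x⁻¹ * z⁻¹ * y * w * x⁻¹ * w⁻¹ * y⁻¹ * w⁻¹,
      x * x * z * x * w * x⁻¹ * z⁻¹ * y * w * x⁻¹ * w⁻¹ * y⁻¹ * w⁻¹,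
      z * x * w * x⁻¹ * z⁻¹ * y * w * x⁻¹ * w⁻¹ * y⁻¹ * w⁻¹,
      w * x⁻¹ * z⁻¹ * y * w * x⁻¹ * w⁻¹ * y⁻¹ * w⁻¹,
      z⁻¹ * y⁻¹ * y⁻¹ * z⁻¹ * y * x⁻¹ * z⁻¹ * y * w * x⁻¹ * z⁻¹ * y * w * x⁻¹ * w⁻¹ * y⁻¹ * w⁻¹,
      z⁻¹ * y * x⁻¹ * z⁻¹ * y * w * x⁻¹ * z⁻¹ * y * w * x⁻¹ * w⁻¹ * y⁻¹ * w⁻¹,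
      x⁻¹ * z⁻¹ * y * w * x⁻¹ * z⁻¹ * y * w * x⁻¹ * w⁻¹ * y⁻¹ * w⁻¹,
      w⁻¹ * y⁻¹ * w⁻¹], ?_, ?_⟩
  · change (_ : FreeGroup (Fin 4)) = _
    decide +kernel
  · decide +kernel
end

section
/- Let F be the free group on four generators x, y, z, w, and let C = [[x,y],[z,w]] where [a,b] = a⁻¹b⁻¹ab. Then there is no element u of F with C = u³; that is, the commutator of commutators cannot be written as a single cube, so at least two cubes are required in any expression of C as a product of cubes in F. -/
/-- In the free group of rank 4, the commutator of commutators
`C = [[x,y],[z,w]]` is not a cube. -/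
theorem commutator_of_commutators_not_a_cube :
    let F := FreeGroup (Fin 4)
    let x : F := FreeGroup.of 0
    let y : F := FreeGroup.of 1
    let z : F := FreeGroup.of 2
    let w : F := FreeGroup.of 3
    let comm : F → F → F := fun a b => a⁻¹ * b⁻¹ * a * b
    let C : F := comm (comm x y) (comm z w)
    ¬ ∃ u : F, C = u ^ 3 := by
  intro F x y z w comm C
  rintro ⟨u, hu⟩
  let g : Fin 4 → Equiv.Perm (Fin 5) :=
    ![Equiv.swap 0 1, Equiv.swap 1 2, Equiv.swap 2 3, Equiv.swap 3 4]
  have h := congrArg (FreeGroup.lift g) hu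
  have hx : FreeGroup.lift g x = Equiv.swap 0 1 := FreeGroup.lift_apply_of
  have hy : FreeGroup.lift g y = Equiv.swap 1 2 := FreeGroup.lift_apply_of
  have hz : FreeGroup.lift g z = Equiv.swap 2 3 := FreeGroup.lift_apply_of
  have hw : FreeGroup.lift g w = Equiv.swap 3 4 := FreeGroup.lift_apply_of
  simp only [C, comm, map_mul, map_inv, map_pow, hx, hy, hz, hw] at h
  generalize FreeGroup.lift g u = v at h
  have h120 : v ^ 120 = 1 := by
    have := pow_card_eq_one (x := v)
    rwa [Fintype.card_perm, Fintype.card_fin] at this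
  have h9 : v ^ 9 = 1 := by
    rw [show 9 = 3 * 3 from rfl, pow_mul, ← h]
    set_option maxRecDepth 100000 in decide
  have h3 : v ^ 3 = 1 := by
    have e : v ^ 3 = (v ^ 9) ^ 27 * ((v ^ 120) ^ 2)⁻¹ := by group
    rw [e, h9, h120]; simp
  rw [h3] at h
  revert h
  decide
end

section
/- Let G be a group of exponent three, i.e., g³ = 1 for every g in G. Then for all elements a, b, c, d of G, the commutator of commutators [[a,b],[c,d]] equals the identity, where [a,b] = a⁻¹b⁻¹ab. -/
section ExpThree

variable {G : Type*} [Group G]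

lemma x3_ring {R : Type*} [Ring R] (P Q : R) (hP : P * P = 0) (hQ : Q * Q = 0)
    (hPQ : (P + Q + P * Q) * (P + Q + P * Q) = 0) : P * Q = - (Q * P) := by
  have e0 : P * Q + Q * P + Q * P * Q + P * Q * P + P * Q * P * Q = 0 := by
    have : (P + Q + P * Q) * (P + Q + P * Q) = P * P + Q * Q + P * P * Q + P * (Q * Q) +
      (P * Q + Q * P + Q * P * Q + P * Q * P + P * Q * P * Q) := by noncomm_ring
    rw [hPQ, hP, hQ] at this
    simpa using this.symm
  have e1 : P * Q * P * Q = 0 := by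
    have : P * (P * Q + Q * P + Q * P * Q + P * Q * P + P * Q * P * Q) * Q =
      P * P * Q * Q + P * Q * P * Q + P * Q * P * (Q * Q) + P * P * Q * P * Q
       + P * P * Q * P * (Q * Q) := by noncomm_ring
    rw [e0, hP, hQ] at this
    simpa using this.symm
  have e2 : P * Q * P = 0 := by
    have : P * (P * Q + Q * P + Q * P * Q + P * Q * P + P * Q * P * Q) =
      P * P * Q + P * Q * P + P * Q * P * Q + P * P * Q * P + P * P * Q * P * Q := by noncomm_ring
    rw [e0, hP, e1] at this
    simpa using this.symm
  have e3 : Q * P * Q = 0 := by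
    have : (P * Q + Q * P + Q * P * Q + P * Q * P + P * Q * P * Q) * Q =
      P * (Q * Q) + Q * P * Q + Q * P * (Q * Q) + P * Q * P * Q + P * Q * P * (Q * Q) := by
      noncomm_ring
    rw [e0, hQ, e1] at this
    simpa using this.symm
  rw [e1, e2, e3] at e0
  simp only [add_zero] at e0
  exact eq_neg_of_add_eq_zero_left e0

lemma x3_rep {R : Type*} [Ring R] (h3 : (3 : R) = 0) (r : G →* R)
    (hr : ∀ g, 1 + r g + r g * r g = 0) (g k : G) :
    (r g - 1) * (r k - 1) = - ((r k - 1) * (r g - 1)) ∧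
    r (k * g * k⁻¹ * g⁻¹) - 1 = - ((r k - 1) * (r g - 1)) := by
  have sq : ∀ g, (r g - 1) * (r g - 1) = 0 := by
    intro g
    have : (r g - 1) * (r g - 1) = (1 + r g + r g * r g) - 3 * r g := by noncomm_ring
    rw [this, hr, h3]; simp
  have inv : ∀ g, r g⁻¹ = 1 - (r g - 1) := by
    intro g
    have e : r g * (1 - (r g - 1)) = 1 := by
      have : r g * (1 - (r g - 1)) = 1 - (r g - 1) * (r g - 1) := by noncomm_ring
      rw [this, sq]; simp
    calc r g⁻¹ = r g⁻¹ * (r g * (1 - (r g - 1))) := by rw [e, mul_one]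
      _ = _ := by rw [← mul_assoc, ← map_mul]; simp
  have anti : ∀ g k, (r g - 1) * (r k - 1) = - ((r k - 1) * (r g - 1)) := by
    intro g k
    refine x3_ring _ _ (sq g) (sq k) ?_
    have : (r g - 1) + (r k - 1) + (r g - 1) * (r k - 1) = r (g * k) - 1 := by
      rw [map_mul]; noncomm_ring
    rw [this, sq]
  refine ⟨anti g k, ?_⟩
  rw [map_mul, map_mul, map_mul, inv, inv]
  have a := anti g k
  have sg := sq g
  have sk := sq k
  obtain ⟨P, hP⟩ : ∃ P, P = r g - 1 := ⟨_, rfl⟩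
  obtain ⟨Q, hQ⟩ : ∃ Q, Q = r k - 1 := ⟨_, rfl⟩
  rw [show r g = 1 + P by rw [hP]; abel, show r k = 1 + Q by rw [hQ]; abel]
  rw [← hP, ← hQ] at a
  rw [← hP] at sg
  rw [← hQ] at sk
  simp only [add_sub_cancel_left]
  have e : (1 + Q) * (1 + P) * (1 - Q) * (1 - P) - 1 =
     Q * P - P * Q + (P * Q) * P - Q * Q + Q * Q * P  - P * P - Q * (P * P)
       - Q * (P * Q) + Q * (P * Q) * P := by noncomm_ring
  rw [e, a, sg, sk]
  have e' : Q * P - -(Q * P) + -(Q * P) * P - 0 + 0 * P - 0 - Q * 0 - Q * -(Q * P) + Q * -(Q * P) * P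
    = 3 * (Q * P) - Q * P - Q * (P * P) + Q * Q * P - Q * Q * (P * P) := by noncomm_ring
  rw [e', h3, sg, sk]; simp

def x3C (x y : G) : G := x⁻¹ * y⁻¹ * x * y

lemma x3_sum (h : ∀ g : G, g ^ 3 = 1) (x g : G) :
    x * (g * x * g⁻¹) * (g * (g * x * g⁻¹) * g⁻¹) = 1 := by
  have h1 := h (x * g)
  have h2 := h g
  have : x * (g * x * g⁻¹) * (g * (g * x * g⁻¹) * g⁻¹) = (x * g) ^ 3 * (g ^ 3)⁻¹ := by
    simp only [pow_succ, pow_zero]; group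
  rw [this, h1, h2]; simp

lemma x3_comm (h : ∀ g : G, g ^ 3 = 1) (x g : G) : Commute x (g * x * g⁻¹) := by
  have h1 := x3_sum h x g
  have h2 := x3_sum h x g⁻¹
  have i : g⁻¹ = g * g := by
    have := h g
    rw [pow_succ, pow_two] at this
    exact inv_eq_of_mul_eq_one_left this
  have j : g⁻¹ * (g⁻¹ * x * g⁻¹⁻¹) * g⁻¹⁻¹ = g * x * g⁻¹ := by
    have : g⁻¹ * g⁻¹ = g := by
      rw [← mul_inv_rev, ← i, inv_inv]
    calc _ = (g⁻¹ * g⁻¹) * x * (g⁻¹ * g⁻¹)⁻¹ := by simp [mul_assoc]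
      _ = _ := by rw [this]
  have k : g * (g * x * g⁻¹) * g⁻¹ = g⁻¹ * x * g⁻¹⁻¹ := by
    rw [inv_inv]
    calc _ = (g * g) * x * (g * g)⁻¹ := by group
      _ = _ := by rw [← i, inv_inv]
  rw [j] at h2
  rw [k] at h1
  generalize g * x * g⁻¹ = u at *
  generalize g⁻¹ * x * g⁻¹⁻¹ = v at *
  -- x u v = 1, x v u = 1
  have e1 : v * (x * u) = 1 := by
    rw [mul_eq_one_iff_eq_inv, eq_comm, inv_eq_iff_mul_eq_one]; exact h1
  have e2 : v * (u * x) = 1 := by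
    have : x * (v * u) = 1 := by rw [← mul_assoc]; exact h2
    have := mul_eq_one_comm.mp this
    rw [← mul_assoc]; exact this
  exact mul_left_cancel (e1.trans e2.symm)

lemma x3_key (h : ∀ g : G, g ^ 3 = 1) (x g k : G) :
    x3C (x3C x g) k = (x3C (x3C x k) g)⁻¹ ∧ x3C x (x3C g k) = (x3C (x3C x g) k)⁻¹ := by
  let N : Subgroup G := Subgroup.normalClosure {x}
  have hc : ∀ a b : N, a * b = b * a := by
    have : IsMulCommutative N := by
      apply Subgroup.isMulCommutative_closure
      intro a ha b hb
      rw [Group.mem_conjugatesOfSet_iff] at ha hb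
      obtain ⟨y, hy, ha⟩ := ha
      obtain ⟨z, hz, hb⟩ := hb
      rw [Set.mem_singleton_iff] at hy hz
      subst hy
      subst hz
      obtain ⟨c, hc⟩ := isConj_iff.1 ha
      obtain ⟨d, hd⟩ := isConj_iff.1 hb
      have := x3_comm h a (d * c⁻¹)
      have e : d * c⁻¹ * a * (d * c⁻¹)⁻¹ = b := by rw [← hd, ← hc]; group
      rw [e] at this
      exact this
    exact fun a b => mul_comm' a b
  letI : CommGroup N := { (inferInstance : Group N) with mul_comm := hc }
  have ext' : ∀ a b : Additive N, ((a.toMul : N) : G) = ((b.toMul : N) : G) → a = b :=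
    fun a b e => Subtype.ext e
  let r : G →* AddMonoid.End (Additive N) :=
    { toFun := fun g => MonoidHom.toAdditive ((MulAut.conjNormal g : MulAut N) : N →* N)
      map_one' := by apply AddMonoidHom.ext; intro a; apply ext'; change (1 : G) * _ * (1 : G)⁻¹ = _; simp; rfl
      map_mul' := by 
        intro a b; apply AddMonoidHom.ext; intro c; apply ext'
        change (a * b : G) * ((c.toMul : N) : G) * (a * b : G)⁻¹ =
          a * (b * ((c.toMul : N) : G) * b⁻¹) * a⁻¹
        simp [mul_assoc] }
  have rv : ∀ (g : G) (n : Additive N), (((r g n).toMul : N) : G) = g * (n.toMul : N) * g⁻¹ := by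
    intro g n; rfl
  have hr : ∀ g, 1 + r g + r g * r g = 0 := by
    intro g
    apply AddMonoidHom.ext
    intro n
    apply ext'
    exact x3_sum h (n.toMul : N) g
  have h3 : (3 : AddMonoid.End (Additive N)) = 0 := by
    have := hr 1
    rw [map_one, mul_one] at this
    rw [← this]; norm_num
  have dv : ∀ (g : G) (n : Additive N), ((((r g⁻¹ - 1) n).toMul : N) : G) = x3C ((n.toMul : N) : G) g := by
    intro g n
    have : (r g⁻¹ - 1) n = - n + r g⁻¹ n := by
      rw [add_comm, ← sub_eq_add_neg]; rfl
    rw [this]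
    change ((n.toMul : N) : G)⁻¹ * (g⁻¹ * ((n.toMul : N) : G) * g⁻¹⁻¹) = _
    simp only [x3C]; group
  let X : Additive N := Additive.ofMul ⟨x, Subgroup.subset_normalClosure rfl⟩
  have hX : ((X.toMul : N) : G) = x := rfl
  obtain ⟨A, B⟩ := x3_rep h3 r hr g⁻¹ k⁻¹
  have A' := congrArg (fun f : AddMonoid.End (Additive N) => (((f X).toMul : N) : G)) A
  have B' := congrArg (fun f : AddMonoid.End (Additive N) => (((f X).toMul : N) : G)) B
  have ng : ∀ (f : AddMonoid.End (Additive N)), ((((-f) X).toMul : N) : G) = (((f X).toMul : N) : G)⁻¹ :=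
    fun f => rfl
  have ml : ∀ (f f' : AddMonoid.End (Additive N)), (f * f') X = f (f' X) := fun f f' => rfl
  have ci : k⁻¹ * g⁻¹ * k⁻¹⁻¹ * g⁻¹⁻¹ = (x3C g k)⁻¹ := by simp only [x3C]; group
  simp only [ci, ng, ml, dv, hX] at A' B'
  exact ⟨by rw [A', inv_inv], B'⟩

end ExpThree

/-- In a group of exponent three, every commutator of
commutators `[[a,b],[c,d]]` (with `[a,b] = a⁻¹b⁻¹ab`) is trivial. -/
theorem commutator_of_commutators_trivial_of_exponent_three
    {G : Type*} [Group G] (h : ∀ g : G, g ^ 3 = 1) (a b c d : G) :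
    (a⁻¹ * b⁻¹ * a * b)⁻¹ * (c⁻¹ * d⁻¹ * c * d)⁻¹ *
      (a⁻¹ * b⁻¹ * a * b) * (c⁻¹ * d⁻¹ * c * d) = 1 := by
  have K := fun x g k : G => (x3_key h x g k).1
  have L := fun x g k : G => (x3_key h x g k).2
  have sw : ∀ x y : G, x3C y x = (x3C x y)⁻¹ := by intro x y; simp only [x3C]; group
  -- `u` commutes with `[u,k]`
  have iv : ∀ u k : G, x3C u⁻¹ k = (x3C u k)⁻¹ := by
    intro u k
    have := (x3_comm h u k⁻¹).eq
    have e1 : x3C u⁻¹ k = u * (k⁻¹ * u * k⁻¹⁻¹)⁻¹ := by simp only [x3C]; group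
    have e2 : (x3C u k)⁻¹ = (k⁻¹ * u * k⁻¹⁻¹)⁻¹ * u := by simp only [x3C]; group
    rw [e1, e2]
    exact (x3_comm h u k⁻¹).inv_right.eq
  have s1 : ∀ a b c d : G, x3C (x3C (x3C b a) c) d = (x3C (x3C (x3C a b) c) d)⁻¹ := by
    intro a b c d; rw [sw a b, iv, iv]
  have s2 : ∀ a b c d : G, x3C (x3C (x3C a c) b) d = (x3C (x3C (x3C a b) c) d)⁻¹ := by
    intro a b c d; rw [K a c b, iv]
  have s3 : ∀ a b c d : G, x3C (x3C (x3C a b) d) c = (x3C (x3C (x3C a b) c) d)⁻¹ := by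
    intro a b c d; rw [K (x3C a b) d c]
  have t : x3C (x3C (x3C c d) a) b = x3C (x3C (x3C a b) c) d := by
    rw [s2 c a d b, s1 a c d b, s3 a c b d, s2 a b c d]; simp
  have e : x3C (x3C a b) (x3C c d) = (x3C (x3C a b) (x3C c d))⁻¹ := by
    conv_rhs => rw [← sw, L, t, ← L]
  have f := h (x3C (x3C a b) (x3C c d))
  change x3C (x3C a b) (x3C c d) = 1
  generalize x3C (x3C a b) (x3C c d) = w at *
  rw [pow_succ, pow_two] at f
  have : w * w = 1 := by nth_rewrite 1 [e]; simp
  rwa [this, one_mul] at f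
end
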